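/- Let u be three times continuously differentiable on an open set U ⊆ ℂ⁴ with u_{34} ≠ 0 on U, and let λ ∈ ℂ. Then for every twice continuously differentiable f : U → ℂ the identity [L₀,M₀]f = (λ/u_{34}²){(Φ₄ − (u_{344}/u_{34})Φ) f₃ − (Φ₃ − (u_{343}/u_{34})Φ) f₄} holds on U, where [L₀,M₀]f = L₀(M₀f) − M₀(L₀f) and Φ₃, Φ₄ denote the partial derivatives of Φ with respect to z³ and z⁴. -/

import Mathlib

/-!  Coordinates: `z : Fin 4 → ℂ` with paper indices `z¹,z²,z³,z⁴` corresponding to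
`z 0, z 1, z 2, z 3`.  `pd i f` is the partial derivative ∂f/∂zⁱ. -/

/-- Partial derivative of `f : ℂ⁴ → ℂ` in the `i`-th coordinate direction. -/
noncomputable def pd (i : Fin 4) (f : (Fin 4 → ℂ) → ℂ) : (Fin 4 → ℂ) → ℂ :=
  fun z => fderiv ℂ f z (Pi.single i 1)

/-- The left-hand side Φ = α u₁₂u₃₄ + β u₁₃u₂₄ + γ u₁₄u₂₃ of the general heavenly
equation (paper indices 1,2,3,4 ↦ 0,1,2,3). -/
noncomputable def Phi (α β γ : ℂ) (u : (Fin 4 → ℂ) → ℂ) : (Fin 4 → ℂ) → ℂ :=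
  fun z => α * pd 0 (pd 1 u) z * pd 2 (pd 3 u) z
    + β * pd 0 (pd 2 u) z * pd 1 (pd 3 u) z
    + γ * pd 0 (pd 3 u) z * pd 1 (pd 2 u) z

/-- The Lax operator `X₁ f = u₃₄ f₁ − u₁₃ f₄ + γλ(u₃₄ f₁ − u₁₄ f₃)`. -/
noncomputable def X1 (γ lam : ℂ) (u f : (Fin 4 → ℂ) → ℂ) : (Fin 4 → ℂ) → ℂ :=
  fun z => pd 2 (pd 3 u) z * pd 0 f z - pd 0 (pd 2 u) z * pd 3 f z
    + γ * lam * (pd 2 (pd 3 u) z * pd 0 f z - pd 0 (pd 3 u) z * pd 2 f z)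

/-- The Lax operator `X₂ f = u₂₃ f₄ − u₃₄ f₂ + βλ(u₃₄ f₂ − u₂₄ f₃)`. -/
noncomputable def X2 (β lam : ℂ) (u f : (Fin 4 → ℂ) → ℂ) : (Fin 4 → ℂ) → ℂ :=
  fun z => pd 1 (pd 2 u) z * pd 3 f z - pd 2 (pd 3 u) z * pd 1 f z
    + β * lam * (pd 2 (pd 3 u) z * pd 1 f z - pd 1 (pd 3 u) z * pd 2 f z)

/-- `L₀ = (1/u₃₄) X₁`. -/
noncomputable def L0 (γ lam : ℂ) (u f : (Fin 4 → ℂ) → ℂ) : (Fin 4 → ℂ) → ℂ :=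
  fun z => X1 γ lam u f z / pd 2 (pd 3 u) z

/-- `M₀ = (1/u₃₄) X₂`. -/
noncomputable def M0 (β lam : ℂ) (u f : (Fin 4 → ℂ) → ℂ) : (Fin 4 → ℂ) → ℂ :=
  fun z => X2 β lam u f z / pd 2 (pd 3 u) z

theorem pd_contDiffOn {U : Set (Fin 4 → ℂ)} (hU : IsOpen U) {g : (Fin 4 → ℂ) → ℂ} {m n : WithTop ℕ∞}
    (hg : ContDiffOn ℂ n g U) (hmn : m + 1 ≤ n) (i : Fin 4) : ContDiffOn ℂ m (pd i g) U :=
  (hg.fderiv_of_isOpen hU hmn).clm_apply contDiffOn_const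

theorem pd_symm {U : Set (Fin 4 → ℂ)} (hU : IsOpen U) {g : (Fin 4 → ℂ) → ℂ}
    (hg : ContDiffOn ℂ 2 g U) {z : Fin 4 → ℂ} (hz : z ∈ U) (i j : Fin 4) :
    pd i (pd j g) z = pd j (pd i g) z := by
  have hc : ContDiffAt ℂ 2 g z := hg.contDiffAt (hU.mem_nhds hz)
  have hs := hc.isSymmSndFDerivAt (by simp)
  have hd : DifferentiableAt ℂ (fderiv ℂ g) z :=
    (hc.fderiv_right (m := 1) (by norm_num)).differentiableAt (by norm_num)
  have key : ∀ i j : Fin 4, pd i (pd j g) z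
      = fderiv ℂ (fderiv ℂ g) z (Pi.single i 1) (Pi.single j 1) := by
    intro i j
    unfold pd
    rw [fderiv_clm_apply hd (by fun_prop)]
    simp
  rw [key, key]
  exact hs.eq _ _

theorem pd_congr {U : Set (Fin 4 → ℂ)} (hU : IsOpen U) {g h : (Fin 4 → ℂ) → ℂ}
    (hgh : ∀ z ∈ U, g z = h z) {z : Fin 4 → ℂ} (hz : z ∈ U) (i : Fin 4) :
    pd i g z = pd i h z := by
  unfold pd
  rw [Filter.EventuallyEq.fderiv_eq (Filter.eventuallyEq_of_mem (hU.mem_nhds hz) hgh)]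

theorem pd_add' {g h : (Fin 4 → ℂ) → ℂ} {z : Fin 4 → ℂ} (i : Fin 4)
    (hg : DifferentiableAt ℂ g z) (hh : DifferentiableAt ℂ h z) :
    pd i (fun z => g z + h z) z = pd i g z + pd i h z := by
  simp [pd, fderiv_fun_add hg hh]

theorem pd_sub' {g h : (Fin 4 → ℂ) → ℂ} {z : Fin 4 → ℂ} (i : Fin 4)
    (hg : DifferentiableAt ℂ g z) (hh : DifferentiableAt ℂ h z) :
    pd i (fun z => g z - h z) z = pd i g z - pd i h z := by
  simp [pd, fderiv_fun_sub hg hh]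

theorem pd_mul' {g h : (Fin 4 → ℂ) → ℂ} {z : Fin 4 → ℂ} (i : Fin 4)
    (hg : DifferentiableAt ℂ g z) (hh : DifferentiableAt ℂ h z) :
    pd i (fun z => g z * h z) z = pd i g z * h z + g z * pd i h z := by
  simp [pd, fderiv_fun_mul hg hh]; ring

theorem pd_const' {z : Fin 4 → ℂ} (i : Fin 4) (c : ℂ) :
    pd i (fun _ => c) z = 0 := by
  simp [pd]

theorem pd_div' {g h : (Fin 4 → ℂ) → ℂ} {z : Fin 4 → ℂ} (i : Fin 4)
    (hg : DifferentiableAt ℂ g z) (hh : DifferentiableAt ℂ h z) (h0 : h z ≠ 0) :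
    pd i (fun z => g z / h z) z = (pd i g z * h z - g z * pd i h z) / (h z) ^ 2 := by
  have hq : DifferentiableAt ℂ (fun z => g z / h z) z := by fun_prop (disch := assumption)
  have hc : ContinuousAt h z := hh.continuousAt
  have e := pd_mul' i hq hh
  have e2 : pd i (fun z => g z / h z * h z) z = pd i g z := by
    unfold pd
    rw [Filter.EventuallyEq.fderiv_eq (f₁ := fun z => g z / h z * h z) (f := g)]
    filter_upwards [hc.eventually_ne h0] with w hw
    field_simp
  rw [e2] at e
  rw [e]
  field_simp
  ring

section
variable {u f : (Fin 4 → ℂ) → ℂ} {z : Fin 4 → ℂ}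

theorem pd_Phi (α β γ : ℂ) (hu : ∀ i j, DifferentiableAt ℂ (pd i (pd j u)) z) (k : Fin 4) :
    pd k (Phi α β γ u) z =
      α * (pd k (pd 0 (pd 1 u)) z * pd 2 (pd 3 u) z + pd 0 (pd 1 u) z * pd k (pd 2 (pd 3 u)) z)
      + β * (pd k (pd 0 (pd 2 u)) z * pd 1 (pd 3 u) z + pd 0 (pd 2 u) z * pd k (pd 1 (pd 3 u)) z)
      + γ * (pd k (pd 0 (pd 3 u)) z * pd 1 (pd 2 u) z + pd 0 (pd 3 u) z * pd k (pd 1 (pd 2 u)) z) := by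
  unfold Phi
  simp (discharger := fun_prop) only [pd_add', pd_mul', pd_const']
  ring

theorem pd_L0 (γ lam : ℂ) (hu : ∀ i j, DifferentiableAt ℂ (pd i (pd j u)) z)
    (hf : ∀ i, DifferentiableAt ℂ (pd i f) z) (h0 : pd 2 (pd 3 u) z ≠ 0) (k : Fin 4) :
    pd k (L0 γ lam u f) z =
      ((pd k (pd 2 (pd 3 u)) z * pd 0 f z + pd 2 (pd 3 u) z * pd k (pd 0 f) z
        - (pd k (pd 0 (pd 2 u)) z * pd 3 f z + pd 0 (pd 2 u) z * pd k (pd 3 f) z)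
        + γ * lam * (pd k (pd 2 (pd 3 u)) z * pd 0 f z + pd 2 (pd 3 u) z * pd k (pd 0 f) z
        - (pd k (pd 0 (pd 3 u)) z * pd 2 f z + pd 0 (pd 3 u) z * pd k (pd 2 f) z)))
        * pd 2 (pd 3 u) z - X1 γ lam u f z * pd k (pd 2 (pd 3 u)) z) / (pd 2 (pd 3 u) z) ^ 2 := by
  unfold L0
  rw [pd_div' k (by unfold X1; fun_prop) (by fun_prop) h0]
  congr 3
  unfold X1
  simp (discharger := fun_prop) only [pd_add', pd_sub', pd_mul', pd_const']
  ring

theorem pd_M0 (β lam : ℂ) (hu : ∀ i j, DifferentiableAt ℂ (pd i (pd j u)) z)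
    (hf : ∀ i, DifferentiableAt ℂ (pd i f) z) (h0 : pd 2 (pd 3 u) z ≠ 0) (k : Fin 4) :
    pd k (M0 β lam u f) z =
      ((pd k (pd 1 (pd 2 u)) z * pd 3 f z + pd 1 (pd 2 u) z * pd k (pd 3 f) z
        - (pd k (pd 2 (pd 3 u)) z * pd 1 f z + pd 2 (pd 3 u) z * pd k (pd 1 f) z)
        + β * lam * (pd k (pd 2 (pd 3 u)) z * pd 1 f z + pd 2 (pd 3 u) z * pd k (pd 1 f) z
        - (pd k (pd 1 (pd 3 u)) z * pd 2 f z + pd 1 (pd 3 u) z * pd k (pd 2 f) z)))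
        * pd 2 (pd 3 u) z - X2 β lam u f z * pd k (pd 2 (pd 3 u)) z) / (pd 2 (pd 3 u) z) ^ 2 := by
  unfold M0
  rw [pd_div' k (by unfold X2; fun_prop) (by fun_prop) h0]
  congr 3
  unfold X2
  simp (discharger := fun_prop) only [pd_add', pd_sub', pd_mul', pd_const']
  ring

end

/-- for `u` C³ on open `U` with `u₃₄ ≠ 0` on `U`, the commutator of the Lax
operators on a C² function `f` equals
`(λ/u₃₄²){(Φ₄ − (u₃₄₄/u₃₄)Φ) f₃ − (Φ₃ − (u₃₄₃/u₃₄)Φ) f₄}` on `U`. -/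
theorem lax_commutator_formula
    (U : Set (Fin 4 → ℂ)) (hU : IsOpen U)
    (u : (Fin 4 → ℂ) → ℂ) (hu : ContDiffOn ℂ 3 u U)
    (h34 : ∀ z ∈ U, pd 2 (pd 3 u) z ≠ 0)
    (α β γ lam : ℂ) (hαβγ : α + β + γ = 0)
    (f : (Fin 4 → ℂ) → ℂ) (hf : ContDiffOn ℂ 2 f U) :
    ∀ z ∈ U,
      L0 γ lam u (M0 β lam u f) z - M0 β lam u (L0 γ lam u f) z
        = lam / (pd 2 (pd 3 u) z) ^ 2 *
          ((pd 3 (Phi α β γ u) z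
              - pd 2 (pd 3 (pd 3 u)) z / pd 2 (pd 3 u) z * Phi α β γ u z) * pd 2 f z
           - (pd 2 (Phi α β γ u) z
              - pd 2 (pd 3 (pd 2 u)) z / pd 2 (pd 3 u) z * Phi α β γ u z) * pd 3 f z) := by
  intro z hz
  have hu1 : ∀ i, ContDiffOn ℂ 2 (pd i u) U := fun i => pd_contDiffOn hU hu (by norm_num) i
  have hu2 : ∀ i j, ContDiffOn ℂ 1 (pd i (pd j u)) U := fun i j =>
    pd_contDiffOn hU (hu1 j) (by norm_num) i
  have hf1 : ∀ i, ContDiffOn ℂ 1 (pd i f) U := fun i => pd_contDiffOn hU hf (by norm_num) i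
  have du : ∀ i j, DifferentiableAt ℂ (pd i (pd j u)) z := fun i j =>
    ((hu2 i j).contDiffAt (hU.mem_nhds hz)).differentiableAt (by norm_num)
  have df : ∀ i, DifferentiableAt ℂ (pd i f) z := fun i =>
    ((hf1 i).contDiffAt (hU.mem_nhds hz)).differentiableAt (by norm_num)
  have h0 := h34 z hz
  have sf : ∀ i j, pd i (pd j f) z = pd j (pd i f) z := pd_symm hU hf hz
  have sa : ∀ i j k, pd i (pd j (pd k u)) z = pd j (pd i (pd k u)) z := fun i j k =>
    pd_symm hU (hu1 k) hz i j
  have sb : ∀ i j k, pd i (pd j (pd k u)) z = pd i (pd k (pd j u)) z := fun i j k =>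
    pd_congr hU (fun w hw => pd_symm hU (hu.of_le (by norm_num)) hw j k) hz i
  have hα : α = -β - γ := by linear_combination hαβγ
  have eL : L0 γ lam u (M0 β lam u f) z = X1 γ lam u (M0 β lam u f) z / pd 2 (pd 3 u) z := rfl
  have eM : M0 β lam u (L0 γ lam u f) z = X2 β lam u (L0 γ lam u f) z / pd 2 (pd 3 u) z := rfl
  rw [eL, eM, X1, X2]
  simp only [pd_L0 γ lam du df h0, pd_M0 β lam du df h0, pd_Phi α β γ du]
  simp only [X1, X2, Phi]
  rw [sf 1 0, sf 2 0, sf 3 0, sf 2 1, sf 3 1, sf 3 2]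
  simp only [sa 1 0, sa 2 0, sa 3 0, sa 2 1, sa 3 1, sa 3 2,
    sb _ 1 0, sb _ 2 0, sb _ 3 0, sb _ 2 1, sb _ 3 1, sb _ 3 2]
  subst hα
  generalize pd 2 (pd 3 u) z = a at *
  field_simp
  ring
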